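/- Let G be a connected finite simple graph that is not the path on two vertices, with adjacency matrix A, degree matrix D = diag(A𝟙), maximum degree d_max = max_i (A𝟙)_i, and let Z = [[O, I],[I − D, A]] ∈ ℝ^{2n×2n} with spectral radius ρ(Z). If 1/(d_max − 1) < α < 1/ρ(Z), then the deformed graph Laplacian 𝒜(α) = I − αA − α²(I − D) satisfies: (i) all its off-diagonal entries are ≤ 0 (equal to −α A_{ij}), (ii) all its diagonal entries 1 + α²((A𝟙)_i − 1) are positive, and (iii) 𝒜(α) is invertible with entrywise nonnegative inverse 𝒜(α)^{-1} = (1 − α²)^{-1} Σ_{k=0}^∞ α^k p_k ≥ 0; hence 𝒜(α) is an M-matrix. -/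

import Mathlib

open Matrix
open scoped ENNReal

section NonbacktrackingWalks

variable {ι : Type*} [Fintype ι] [DecidableEq ι]

/-- `nbCount A k i j l` counts the nonbacktracking walks of length `k + 1` from `i` to `l` whose
first step goes to `j`, in the graph with adjacency matrix `A`. -/
def nbCount (A : Matrix ι ι ℝ) : ℕ → ι → ι → ι → ℝ
  | 0 => fun i j l => A i j * (1 : Matrix ι ι ℝ) j l
  | k + 1 => fun i j l => A i j * ∑ m ∈ Finset.univ.erase i, nbCount A k j m l

lemma nbCount_nonneg {A : Matrix ι ι ℝ} (hA : ∀ i j, 0 ≤ A i j) (k : ℕ) (i j l : ι) :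
    0 ≤ nbCount A k i j l := by
  induction k generalizing i j with
  | zero =>
    refine mul_nonneg (hA i j) ?_
    rw [Matrix.one_apply]
    split_ifs <;> norm_num
  | succ k ih => exact mul_nonneg (hA i j) (Finset.sum_nonneg fun m _ => ih j m)

/-- The matrix counting nonbacktracking walks of length `k + 1`. -/
def nbMatrix (A : Matrix ι ι ℝ) (k : ℕ) : Matrix ι ι ℝ :=
  Matrix.of fun i l => ∑ j, nbCount A k i j l

lemma nbCount_succ (A : Matrix ι ι ℝ) (k : ℕ) (i j l : ι) :
    nbCount A (k + 1) i j l = A i j * (nbMatrix A k j l - nbCount A k j i l) := by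
  simp only [nbCount, nbMatrix, Matrix.of_apply]
  rw [← Finset.add_sum_erase _ _ (Finset.mem_univ i)]
  ring

lemma nbMatrix_zero (A : Matrix ι ι ℝ) : nbMatrix A 0 = A := by
  ext i l
  simp [nbMatrix, nbCount, Matrix.one_apply]

lemma nbMatrix_succ_apply (A : Matrix ι ι ℝ) (k : ℕ) (i l : ι) :
    nbMatrix A (k + 1) i l = (A * nbMatrix A k) i l - ∑ j, A i j * nbCount A k j i l := by
  rw [nbMatrix, Matrix.of_apply, Matrix.mul_apply, ← Finset.sum_sub_distrib]
  exact Finset.sum_congr rfl fun j _ => by rw [nbCount_succ]; ring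

lemma nbMatrix_one {A : Matrix ι ι ℝ} (hA : ∀ i j, A i j * A j i = A i j) :
    nbMatrix A 1 = A ^ 2 - Matrix.diagonal (A *ᵥ fun _ => (1 : ℝ)) := by
  ext i l
  rw [nbMatrix_succ_apply, nbMatrix_zero, pow_two, Matrix.sub_apply]
  congr 1
  simp only [nbCount, ← mul_assoc, hA, ← Finset.sum_mul]
  by_cases h : i = l
  · subst h; simp [Matrix.mulVec, dotProduct]
  · simp [h]

lemma nbMatrix_add_two {A : Matrix ι ι ℝ} (hA : ∀ i j, A i j * A j i = A i j)
    (hA' : ∀ i j, A i j * A i j = A i j) (k : ℕ) :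
    nbMatrix A (k + 2) = A * nbMatrix A (k + 1)
      + (1 - Matrix.diagonal (A *ᵥ fun _ => (1 : ℝ))) * nbMatrix A k := by
  have hF : ∀ i j l, A i j * nbCount A k i j l = nbCount A k i j l := by
    intro i j l
    cases k <;> simp only [nbCount, ← mul_assoc, hA']
  ext i l
  have h : ∑ j, A i j * nbCount A (k + 1) j i l
      = (A *ᵥ fun _ => (1 : ℝ)) i * nbMatrix A k i l - nbMatrix A k i l := by
    simp only [nbCount_succ, ← mul_assoc, hA, mul_sub, hF, Finset.sum_sub_distrib,
      ← Finset.sum_mul]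
    simp [Matrix.mulVec, dotProduct, nbMatrix]
  rw [nbMatrix_succ_apply, h, Matrix.add_apply, sub_mul, Matrix.sub_apply, one_mul,
    Matrix.diagonal_mul]
  ring

end NonbacktrackingWalks

section SpectralRadius

open Filter

attribute [local instance] Matrix.linftyOpNormedRing Matrix.linftyOpNormedAlgebra in
/-- Entrywise convergence of the resolvent power series inside the disc given by the spectral
radius. -/
lemma summable_pow_mul_pow_apply {ι : Type*} [Fintype ι] [DecidableEq ι] (M : Matrix ι ι ℝ)
    {a : ℝ} (ha : 0 ≤ a)
    (h : ENNReal.ofReal a < (spectralRadius ℂ (M.map Complex.ofReal))⁻¹) (i j : ι) :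
    Summable fun k : ℕ => a ^ k * (M ^ k) i j := by
  set N : Matrix ι ι ℂ := M.map Complex.ofReal
  obtain ⟨c, hrc, hca⟩ := exists_between (ENNReal.lt_inv_iff_lt_inv.mp h)
  have hctop : c ≠ ⊤ := hca.ne_top
  lift c to NNReal using hctop
  have hac : a * c < 1 := by
    have h1 : (c : ENNReal) * ENNReal.ofReal a < 1 := by
      rcases ha.eq_or_lt with rfl | hpos
      · simp
      · calc (c : ENNReal) * ENNReal.ofReal a < (ENNReal.ofReal a)⁻¹ * ENNReal.ofReal a :=
              ENNReal.mul_lt_mul_left (by simpa using hpos) ENNReal.ofReal_ne_top hca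
          _ = 1 := ENNReal.inv_mul_cancel (by simpa using hpos) ENNReal.ofReal_ne_top
    rw [← ENNReal.ofReal_coe_nnreal, ← ENNReal.ofReal_mul c.coe_nonneg,
      ENNReal.ofReal_lt_one] at h1
    linarith
  have hev : ∀ᶠ k : ℕ in atTop, ‖a ^ k * (M ^ k) i j‖ ≤ (a * c) ^ k := by
    have hlim := spectrum.pow_nnnorm_pow_one_div_tendsto_nhds_spectralRadius N
    filter_upwards [hlim.eventually_lt_const hrc, eventually_gt_atTop 0] with k hk hk0
    have h2 : (‖N ^ k‖₊ : ENNReal) ≤ (c : ENNReal) ^ k := by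
      have := ENNReal.rpow_le_rpow hk.le (Nat.cast_nonneg (α := ℝ) k)
      rwa [← ENNReal.rpow_mul, one_div_mul_cancel (by positivity), ENNReal.rpow_one,
        ENNReal.rpow_natCast] at this
    have h3 : ‖N ^ k‖₊ ≤ c ^ k := by exact_mod_cast h2
    have h4 : ‖(N ^ k) i j‖₊ ≤ ‖N ^ k‖₊ := by
      rw [Matrix.linfty_opNNNorm_def]
      exact (Finset.single_le_sum (f := fun j => ‖(N ^ k) i j‖₊) (fun _ _ => zero_le)
        (Finset.mem_univ j)).trans
        (Finset.le_sup (f := fun i => ∑ j, ‖(N ^ k) i j‖₊) (Finset.mem_univ i))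
    have h5 : (N ^ k) i j = ((M ^ k) i j : ℂ) := by
      have : N ^ k = (M ^ k).map Complex.ofReal :=
        (map_pow (Complex.ofRealHom.mapMatrix (m := ι)) M k).symm
      rw [this, Matrix.map_apply]
    have h6 : ‖(M ^ k) i j‖ ≤ (c : ℝ) ^ k := by
      have := h4.trans h3
      rw [h5] at this
      have h7 : ‖((M ^ k) i j : ℂ)‖ ≤ (c : ℝ) ^ k := by exact_mod_cast this
      rwa [Complex.norm_real] at h7
    rw [norm_mul, norm_pow, Real.norm_of_nonneg ha, mul_pow]
    gcongr
  exact Summable.of_norm_bounded_eventually_nat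
    (summable_geometric_of_lt_one (by positivity) hac) hev

lemma one_le_spectralRadius_of_mulVec_eq {ι : Type*} [Fintype ι] [DecidableEq ι]
    {M : Matrix ι ι ℂ} {v : ι → ℂ} (hv : v ≠ 0) (h : M *ᵥ v = v) :
    1 ≤ spectralRadius ℂ M := by
  have hmem : (1 : ℂ) ∈ spectrum ℂ M := by
    rw [spectrum.mem_iff, map_one]
    intro hu
    refine hv ((Matrix.mulVec_injective_iff_isUnit.mpr hu) ?_)
    simp [Matrix.sub_mulVec, h]
  have := le_iSup₂ (f := fun (k : ℂ) (_ : k ∈ spectrum ℂ M) => (‖k‖₊ : ENNReal)) 1 hmem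
  simpa [spectralRadius] using this

/-- If `s • 1 - B` has an entrywise nonnegative left inverse and `B` is entrywise nonnegative, then
the spectrum of `B` lies in the disc of radius `s`. -/
lemma norm_le_of_mem_spectrum_of_nonneg_inverse {ι : Type*} [Fintype ι] [DecidableEq ι]
    {s : ℝ} {B C : Matrix ι ι ℝ} (hB : ∀ i j, 0 ≤ B i j) (hC : ∀ i j, 0 ≤ C i j)
    (hinv : C * (s • (1 : Matrix ι ι ℝ) - B) = 1) {z : ℂ}
    (hz : z ∈ spectrum ℂ (B.map Complex.ofReal)) : ‖z‖ ≤ s := by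
  rw [← Matrix.spectrum_toLin', ← Module.End.hasEigenvalue_iff_mem_spectrum] at hz
  obtain ⟨v, hv⟩ := hz.exists_hasEigenvector
  have hBv : B.map Complex.ofReal *ᵥ v = z • v := by simpa using hv.apply_eq_smul
  by_contra! hlt
  set w : ι → ℝ := fun i => ‖v i‖ with hw
  have hle : ∀ i, ((s • (1 : Matrix ι ι ℝ) - B) *ᵥ w) i ≤ 0 := by
    intro i
    have h1 : ‖z‖ * w i ≤ (B *ᵥ w) i := by
      calc ‖z‖ * w i = ‖(B.map Complex.ofReal *ᵥ v) i‖ := by simp [hBv, hw]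
        _ ≤ ∑ j, ‖(B i j : ℂ) * v j‖ := norm_sum_le _ _
        _ = (B *ᵥ w) i := Finset.sum_congr rfl fun j _ => by
          rw [norm_mul, Complex.norm_real, Real.norm_of_nonneg (hB i j)]
    have h2 : ((s • (1 : Matrix ι ι ℝ) - B) *ᵥ w) i = s * w i - (B *ᵥ w) i := by
      simp [Matrix.sub_mulVec, Matrix.smul_mulVec]
    have h3 : s * w i ≤ ‖z‖ * w i := mul_le_mul_of_nonneg_right hlt.le (norm_nonneg _)
    linarith
  refine hv.2 (funext fun i => ?_)
  have h4 : w i = ∑ j, C i j * ((s • (1 : Matrix ι ι ℝ) - B) *ᵥ w) j := by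
    calc w i = ((C * (s • (1 : Matrix ι ι ℝ) - B)) *ᵥ w) i := by rw [hinv, Matrix.one_mulVec]
      _ = _ := by rw [← Matrix.mulVec_mulVec]; rfl
  have h5 : w i ≤ 0 := h4 ▸ Finset.sum_nonpos fun j _ =>
    mul_nonpos_of_nonneg_of_nonpos (hC i j) (hle j)
  exact norm_le_zero_iff.mp h5

end SpectralRadius

section Series

variable {ι : Type*} [Fintype ι] [DecidableEq ι]

/-- Generating function identity for sequences satisfying the nonbacktracking recurrence. -/
lemma mul_tsum_pow_smul_eq {A D : Matrix ι ι ℝ} {p : ℕ → Matrix ι ι ℝ}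
    (hp0 : p 0 = 1) (hp1 : p 1 = A) (hp2 : p 2 = A ^ 2 - D)
    (hprec : ∀ k, 3 ≤ k → p k = A * p (k - 1) + (1 - D) * p (k - 2)) {a : ℝ}
    (hs : Summable fun k => a ^ k • p k) :
    (1 - a • A - a ^ 2 • (1 - D)) * ∑' k, a ^ k • p k = (1 - a ^ 2) • (1 : Matrix ι ι ℝ) := by
  set f : ℕ → Matrix ι ι ℝ := fun k => a ^ k • p k with hf
  have hs1 : Summable fun k => f (k + 1) := (summable_nat_add_iff 1).mpr hs
  have hrec : ∀ k, f (k + 3) = a • A * f (k + 2) + a ^ 2 • (1 - D) * f (k + 1) := by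
    intro k
    simp only [hf, hprec (k + 3) (by omega), smul_mul_smul_comm, smul_add]
    congr 2 <;> ring
  have hs2 : Summable fun k => f (k + 2) := (summable_nat_add_iff 2).mpr hs
  have e1 : ∑' k, f k = f 0 + ∑' k, f (k + 1) := hs.tsum_eq_zero_add
  have e2 : ∑' k, f (k + 1) = f 1 + ∑' k, f (k + 2) := hs1.tsum_eq_zero_add
  have e3 : ∑' k, f (k + 2) = f 2 + ∑' k, f (k + 3) := hs2.tsum_eq_zero_add
  have e4 : ∑' k, f (k + 3)
      = a • A * ∑' k, f (k + 2) + a ^ 2 • (1 - D) * ∑' k, f (k + 1) := by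
    simp only [hrec]
    rw [(hs2.mul_left _).tsum_add (hs1.mul_left _), hs2.tsum_mul_left, hs1.tsum_mul_left]
  have f0 : f 0 = 1 := by simp [hf, hp0]
  have f1 : f 1 = a • A := by simp [hf, hp1]
  have f2 : f 2 = a • A * (a • A) - a ^ 2 • D := by
    simp [hf, hp2, smul_sub, smul_smul, pow_two]
  set S := ∑' k, f k
  have g1 : ∑' k, f (k + 1) = S - 1 := by rw [e1, f0]; abel
  have g2 : ∑' k, f (k + 2) = S - 1 - a • A := by rw [← g1, e2, f1]; abel
  rw [e4, g2, g1, f2] at e3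
  have key : (1 - a • A - a ^ 2 • (1 - D)) * S
      = 1 - a ^ 2 • D - a ^ 2 • (1 - D) := by
    have : S = 1 + a • A + (a • A * (a • A) - a ^ 2 • D
      + (a • A * (S - 1 - a • A) + a ^ 2 • (1 - D) * (S - 1))) := by rw [← e3]; abel
    calc _ = S - a • A * S - a ^ 2 • (1 - D) * S := by rw [sub_mul, sub_mul, one_mul]
      _ = (1 + a • A + (a • A * (a • A) - a ^ 2 • D
      + (a • A * (S - 1 - a • A) + a ^ 2 • (1 - D) * (S - 1))))
        - a • A * S - a ^ 2 • (1 - D) * S := by rw [← this]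
      _ = _ := by noncomm_ring
  rw [key, sub_smul, one_smul, smul_sub]
  abel

/-- Powers of the block companion matrix propagate the nonbacktracking recurrence. -/
lemma fromBlocks_pow_mul_fromRows {A D : Matrix ι ι ℝ} {p : ℕ → Matrix ι ι ℝ}
    (hprec : ∀ k, 3 ≤ k → p k = A * p (k - 1) + (1 - D) * p (k - 2)) (k : ℕ) :
    (Matrix.fromBlocks 0 1 (1 - D) A : Matrix (ι ⊕ ι) (ι ⊕ ι) ℝ) ^ k
        * Matrix.fromRows (p 1) (p 2) = Matrix.fromRows (p (k + 1)) (p (k + 2)) := by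
  induction k with
  | zero => simp
  | succ k ih =>
    rw [pow_succ', Matrix.mul_assoc, ih, Matrix.fromBlocks_mul_fromRows]
    congr 1
    · simp
    · rw [hprec (k + 1 + 2) (by omega), add_comm]; rfl

lemma summable_pow_smul_of_lt_inv_spectralRadius {A D : Matrix ι ι ℝ} {p : ℕ → Matrix ι ι ℝ}
    (hprec : ∀ k, 3 ≤ k → p k = A * p (k - 1) + (1 - D) * p (k - 2)) {a : ℝ} (ha : 0 ≤ a)
    (h : ENNReal.ofReal a < (spectralRadius ℂ
      ((Matrix.fromBlocks 0 1 (1 - D) A : Matrix (ι ⊕ ι) (ι ⊕ ι) ℝ).map Complex.ofReal))⁻¹) :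
    Summable fun k => a ^ k • p k := by
  rw [← summable_nat_add_iff 1]
  refine Pi.summable.mpr fun i => Pi.summable.mpr fun j => ?_
  have : ∀ k, (a ^ (k + 1) • p (k + 1)) i j = a * ∑ m,
      (a ^ k * ((Matrix.fromBlocks 0 1 (1 - D) A : Matrix (ι ⊕ ι) (ι ⊕ ι) ℝ) ^ k) (Sum.inl i) m)
        * Matrix.fromRows (p 1) (p 2) m j := by
    intro k
    have h1 : p (k + 1) i j = ((Matrix.fromBlocks 0 1 (1 - D) A : Matrix (ι ⊕ ι) (ι ⊕ ι) ℝ) ^ k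
        * Matrix.fromRows (p 1) (p 2)) (Sum.inl i) j := by
      rw [fromBlocks_pow_mul_fromRows hprec]; rfl
    rw [Matrix.smul_apply, h1, Matrix.mul_apply, smul_eq_mul, pow_succ', mul_assoc,
      Finset.mul_sum]
    simp only [mul_assoc]
  simp only [this]
  exact (summable_sum fun m _ =>
    (summable_pow_mul_pow_apply _ ha h _ m).mul_right _).mul_left _

end Series

/-- The nonbacktracking walk count matrices of a graph are entrywise nonnegative. -/
lemma nonneg_of_nonbacktracking_recurrence {ι : Type*} [Fintype ι] [DecidableEq ι]
    (G : SimpleGraph ι) [DecidableRel G.Adj] {p : ℕ → Matrix ι ι ℝ}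
    (hp0 : p 0 = 1) (hp1 : p 1 = G.adjMatrix ℝ)
    (hp2 : p 2 = G.adjMatrix ℝ ^ 2 - Matrix.diagonal (G.adjMatrix ℝ *ᵥ fun _ => (1 : ℝ)))
    (hprec : ∀ k, 3 ≤ k → p k = G.adjMatrix ℝ * p (k - 1)
      + (1 - Matrix.diagonal (G.adjMatrix ℝ *ᵥ fun _ => (1 : ℝ))) * p (k - 2))
    (k : ℕ) (i j : ι) : 0 ≤ p k i j := by
  have hA : ∀ i j, G.adjMatrix ℝ i j * G.adjMatrix ℝ j i = G.adjMatrix ℝ i j := by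
    intro i j
    simp [SimpleGraph.adjMatrix_apply, G.adj_comm j i]
  have hA' : ∀ i j, G.adjMatrix ℝ i j * G.adjMatrix ℝ i j = G.adjMatrix ℝ i j := by
    intro i j
    simp [SimpleGraph.adjMatrix_apply]
  have hA0 : ∀ i j, 0 ≤ G.adjMatrix ℝ i j := by
    intro i j
    rw [SimpleGraph.adjMatrix_apply]
    split_ifs <;> norm_num
  have heq : ∀ k, p (k + 1) = nbMatrix (G.adjMatrix ℝ) k
      ∧ p (k + 2) = nbMatrix (G.adjMatrix ℝ) (k + 1) := by
    intro k
    induction k with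
    | zero => exact ⟨by rw [hp1, nbMatrix_zero], by rw [hp2, nbMatrix_one hA]⟩
    | succ k ih =>
      refine ⟨ih.2, ?_⟩
      rw [nbMatrix_add_two hA hA', ← ih.1, ← ih.2, hprec (k + 1 + 2) (by omega)]
      rfl
  cases k with
  | zero =>
    rw [hp0, Matrix.one_apply]
    split_ifs <;> norm_num
  | succ k =>
    rw [(heq k).1]
    exact Finset.sum_nonneg fun m _ => nbCount_nonneg hA0 k i m j

/-- Let `G` be a connected finite simple graph that is not the path on
two vertices, with adjacency matrix `A = G.adjMatrix ℝ`, degree matrix `D = diag(A𝟙)`,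
maximum degree `d_max = max_i (A𝟙)_i`, nonbacktracking walk count matrices `p`, and block
companion matrix `Z = [[O, I],[I − D, A]]` with spectral radius `ρ(Z)`. If
`1/(d_max − 1) < α < 1/ρ(Z)`, then the deformed graph Laplacian
`𝒜(α) = I − αA − α²(I − D)` has: (i) off-diagonal entries `−α·A i j ≤ 0`; (ii) positive
diagonal entries `1 + α²((A𝟙)_i − 1)`; (iii) an entrywise nonnegative inverse
`(1 − α²)⁻¹ • Σ_k α^k • p k`; hence `𝒜(α)` is an M-matrix. -/
theorem deformed_laplacian_Mmatrix
    {n : ℕ} (G : SimpleGraph (Fin n)) [DecidableRel G.Adj]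
    (hconn : G.Connected)
    (hnotP2 : ¬ Nonempty (G ≃g SimpleGraph.pathGraph 2))
    (A D : Matrix (Fin n) (Fin n) ℝ)
    (hA : A = G.adjMatrix ℝ)
    (hD : D = Matrix.diagonal (A *ᵥ fun _ => (1 : ℝ)))
    (p : ℕ → Matrix (Fin n) (Fin n) ℝ)
    (hp0 : p 0 = 1) (hp1 : p 1 = A) (hp2 : p 2 = A ^ 2 - D)
    (hprec : ∀ k, 3 ≤ k →
      p k = A * p (k - 1) + ((1 : Matrix (Fin n) (Fin n) ℝ) - D) * p (k - 2))
    (Z : Matrix (Fin n ⊕ Fin n) (Fin n ⊕ Fin n) ℝ)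
    (hZ : Z = Matrix.fromBlocks 0 1 ((1 : Matrix (Fin n) (Fin n) ℝ) - D) A)
    (dmax : ℝ) (hdmax : dmax = ⨆ i, (A *ᵥ fun _ => (1 : ℝ)) i)
    (α : ℝ)
    (hαlow : 1 / (dmax - 1) < α)
    (hαhigh : ENNReal.ofReal α < (spectralRadius ℂ (Z.map Complex.ofReal))⁻¹)
    (𝒜 : Matrix (Fin n) (Fin n) ℝ)
    (h𝒜 : 𝒜 = (1 : Matrix (Fin n) (Fin n) ℝ) - α • A
        - α ^ 2 • ((1 : Matrix (Fin n) (Fin n) ℝ) - D)) :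
    (∀ i j, i ≠ j → 𝒜 i j = -(α * A i j) ∧ 𝒜 i j ≤ 0) ∧
    (∀ i, 𝒜 i i = 1 + α ^ 2 * ((A *ᵥ fun _ => (1 : ℝ)) i - 1) ∧ 0 < 𝒜 i i) ∧
    Summable (fun k => α ^ k • p k) ∧
    𝒜 * ((1 - α ^ 2)⁻¹ • ∑' k, α ^ k • p k) = 1 ∧
    ((1 - α ^ 2)⁻¹ • ∑' k, α ^ k • p k) * 𝒜 = 1 ∧
    (∀ i j, 0 ≤ ((1 - α ^ 2)⁻¹ • ∑' k, α ^ k • p k) i j) ∧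
    ∃ (s : ℝ) (B : Matrix (Fin n) (Fin n) ℝ),
      (∀ i j, 0 ≤ B i j) ∧
      (∀ z ∈ spectrum ℂ (B.map Complex.ofReal), ‖z‖ ≤ s) ∧
      𝒜 = s • (1 : Matrix (Fin n) (Fin n) ℝ) - B := by
  subst hA
  set A := G.adjMatrix ℝ with hA
  have hA0 : ∀ i j, 0 ≤ A i j := by
    intro i j
    rw [hA, SimpleGraph.adjMatrix_apply]
    split_ifs <;> norm_num
  have hAdiag : ∀ i, A i i = 0 := fun i => by simp [hA]
  have hd0 : ∀ i, 0 ≤ (A *ᵥ fun _ => (1 : ℝ)) i := fun i =>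
    Finset.sum_nonneg (s := Finset.univ) fun j _ => mul_nonneg (hA0 i j) zero_le_one
  have hne : Nonempty (Fin n) := hconn.nonempty
  have hp : ∀ k i j, 0 ≤ p k i j := by
    subst hD
    exact nonneg_of_nonbacktracking_recurrence G hp0 hp1 hp2 hprec
  have hα1 : α < 1 := by
    have hZ1 : Z *ᵥ (fun _ => (1 : ℝ)) = fun _ => 1 := by
      have h1 : (fun _ => (1 : ℝ) : Fin n ⊕ Fin n → ℝ)
          = Sum.elim (fun _ => 1) (fun _ => 1) := by ext (i | i) <;> rfl
      rw [h1, hZ, Matrix.fromBlocks_mulVec]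
      congr 1
      · simp [Function.comp_def]
      · ext i
        simp [Function.comp_def, hD, Matrix.sub_mulVec, Matrix.mulVec_diagonal]
    have hZc : Z.map Complex.ofReal *ᵥ (fun _ => (1 : ℂ)) = fun _ => 1 := by
      ext i
      have := congrArg Complex.ofReal (congrFun hZ1 i)
      simpa [Matrix.mulVec, dotProduct] using this
    have hv : (fun _ => (1 : ℂ) : Fin n ⊕ Fin n → ℂ) ≠ 0 := fun h =>
      one_ne_zero (congrFun h (Sum.inl hne.some))
    have := hαhigh.trans_le (ENNReal.inv_le_one.mpr (one_le_spectralRadius_of_mulVec_eq hv hZc))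
    exact ENNReal.ofReal_lt_one.mp this
  have hcases : 0 < α ∨ (-1 < α ∧ A = 0 ∧ D = 0) := by
    rcases subsingleton_or_nontrivial (Fin n) with hsub | hnt
    · right
      have hA00 : A = 0 := by
        ext i j
        rw [Subsingleton.elim j i, hAdiag]; rfl
      refine ⟨?_, hA00, by simp [hD, hA00]⟩
      rw [hdmax, hA00] at hαlow
      simpa using hαlow
    · left
      refine lt_of_le_of_lt (one_div_nonneg.mpr (sub_nonneg.mpr ?_)) hαlow
      obtain ⟨j, hj⟩ := hconn.preconnected.exists_adj_of_nontrivial hne.some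
      rw [hdmax]
      refine le_trans ?_ (le_ciSup (Set.finite_range _).bddAbove hne.some)
      calc (1 : ℝ) = A hne.some j * 1 := by simp [hA, SimpleGraph.adjMatrix_apply, hj]
        _ ≤ _ := Finset.single_le_sum (f := fun j => A hne.some j * 1)
          (fun j _ => mul_nonneg (hA0 _ j) zero_le_one) (Finset.mem_univ j)
  have hsq : α ^ 2 < 1 := by
    rw [sq_lt_one_iff_abs_lt_one, abs_lt]
    exact ⟨by rcases hcases with h | h <;> linarith, hα1⟩
  have hseries : Summable (fun k => α ^ k • p k) ∧ ∀ k i j, 0 ≤ (α ^ k • p k) i j := by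
    rcases hcases with h | ⟨-, h1, h2⟩
    · refine ⟨summable_pow_smul_of_lt_inv_spectralRadius hprec h.le (hZ ▸ hαhigh), fun k i j => ?_⟩
      exact mul_nonneg (pow_nonneg h.le k) (hp k i j)
    · have hz : ∀ k, p (k + 1) = 0 ∧ p (k + 2) = 0 := by
        intro k
        induction k with
        | zero => simp [hp1, hp2, h1, h2]
        | succ k ih => exact ⟨ih.2, by rw [hprec (k + 1 + 2) (by omega)]; simp [h1, ih.1]⟩
      refine ⟨?_, fun k i j => ?_⟩
      · rw [← summable_nat_add_iff 1]
        simp [hz]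
      · cases k with
        | zero => simpa using hp 0 i j
        | succ k => simp [(hz k).1]
  obtain ⟨hsum, hterm⟩ := hseries
  have hαA : ∀ i j, 0 ≤ α * A i j := by
    intro i j
    rcases hcases with h | ⟨-, h, -⟩
    · exact mul_nonneg h.le (hA0 i j)
    · simp [h]
  have hoff : ∀ i j, i ≠ j → 𝒜 i j = -(α * A i j) ∧ 𝒜 i j ≤ 0 := by
    intro i j hij
    have h1 : 𝒜 i j = -(α * A i j) := by simp [h𝒜, hD, hij]
    exact ⟨h1, by rw [h1]; linarith [hαA i j]⟩
  have hdiag : ∀ i, 𝒜 i i = 1 + α ^ 2 * ((A *ᵥ fun _ => (1 : ℝ)) i - 1) ∧ 0 < 𝒜 i i := by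
    intro i
    have h1 : 𝒜 i i = 1 + α ^ 2 * ((A *ᵥ fun _ => (1 : ℝ)) i - 1) := by
      rw [h𝒜, hD]
      simp only [Matrix.sub_apply, Matrix.smul_apply, Matrix.one_apply_eq,
        Matrix.diagonal_apply_eq, hAdiag, smul_eq_mul]
      ring
    refine ⟨h1, ?_⟩
    rw [h1]
    nlinarith [mul_nonneg (sq_nonneg α) (hd0 i)]
  have hinv : 𝒜 * ((1 - α ^ 2)⁻¹ • ∑' k, α ^ k • p k) = 1 := by
    rw [Matrix.mul_smul, h𝒜, mul_tsum_pow_smul_eq hp0 hp1 hp2 hprec hsum, smul_smul,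
      inv_mul_cancel₀ (by linarith), one_smul]
  have hinv' := mul_eq_one_comm.mp hinv
  have hnonneg : ∀ i j, 0 ≤ ((1 - α ^ 2)⁻¹ • ∑' k, α ^ k • p k) i j := by
    intro i j
    refine mul_nonneg (inv_nonneg.mpr (by linarith)) ?_
    have h1 : HasSum (fun k => (α ^ k • p k) i j) ((∑' k, α ^ k • p k) i j) :=
      Pi.hasSum.mp (Pi.hasSum.mp hsum.hasSum i) j
    exact h1.nonneg fun k => hterm k i j
  have hBnonneg : ∀ i j, 0 ≤ ((∑ i, 𝒜 i i) • (1 : Matrix (Fin n) (Fin n) ℝ) - 𝒜) i j := by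
    intro i j
    by_cases hij : i = j
    · subst hij
      have := Finset.single_le_sum (f := fun i => 𝒜 i i) (fun i _ => (hdiag i).2.le)
        (Finset.mem_univ i)
      simpa using this
    · simpa [hij] using (hoff i j hij).2
  exact ⟨hoff, hdiag, hsum, hinv, hinv', hnonneg, ∑ i, 𝒜 i i,
    (∑ i, 𝒜 i i) • (1 : Matrix (Fin n) (Fin n) ℝ) - 𝒜, hBnonneg,
    fun z hz => norm_le_of_mem_spectrum_of_nonneg_inverse hBnonneg hnonneg
      (by rw [sub_sub_cancel]; exact hinv') hz,
    by rw [sub_sub_cancel]⟩
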